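/- Let V and W be real vector spaces, let p be a seminorm on V and q a seminorm on W. For t in the tensor product V ⊗ W define (p ⊗ q)(t) = inf { Σ_{k=1}^{N} p(v_k)·q(w_k) : N ∈ ℕ, v_k ∈ V, w_k ∈ W, t = Σ_{k=1}^{N} v_k ⊗ w_k }, the infimum being taken over all finite representations of t as a sum of pure tensors. Then p ⊗ q is a seminorm on V ⊗ W, and for every v ∈ V and w ∈ W one has (p ⊗ q)(v ⊗ w) = p(v)·q(w). -/

import Mathlib

open scoped TensorProduct

/-- A seminorm on a real vector space is attained at any given vector by a dominated functional. -/
theorem Seminorm.exists_dual_apply_eq {V : Type*} [AddCommGroup V] [Module ℝ V]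
    (p : Seminorm ℝ V) (v : V) :
    ∃ f : Module.Dual ℝ V, f v = p v ∧ ∀ x, |f x| ≤ p x := by
  by_cases hv : v = 0
  · exact ⟨0, by simp [hv], fun x => by simp⟩
  let g : V →ₗ.[ℝ] ℝ := LinearPMap.mkSpanSingleton v (p v) hv
  obtain ⟨f, hf, hfp⟩ := Module.Dual.exists_extension_of_le_seminorm_real g.domain g.toFun
    (p := p) (by
      rintro ⟨x, hx⟩
      obtain ⟨c, rfl⟩ := Submodule.mem_span_singleton.1 hx
      have h : g.toFun ⟨c • v, hx⟩ = c * p v := LinearPMap.mkSpanSingleton'_apply v (p v) _ c hx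
      rw [h, map_smul_eq_mul]
      exact mul_le_mul_of_nonneg_right (le_abs_self c) (apply_nonneg p v))
  refine ⟨f, ?_, hfp⟩
  have hmem : v ∈ g.domain := Submodule.mem_span_singleton_self v
  exact (hf ⟨v, hmem⟩).trans (LinearPMap.mkSpanSingleton'_apply_self v (p v) _ hmem)

namespace ProjectiveSeminorm

variable {V W : Type*} [AddCommGroup V] [Module ℝ V] [AddCommGroup W] [Module ℝ W]
  (p : Seminorm ℝ V) (q : Seminorm ℝ W)

/-- The values `Σ p(v_k) q(w_k)` over all representations `t = Σ v_k ⊗ w_k`. -/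
def costs (t : V ⊗[ℝ] W) : Set ℝ :=
  { s : ℝ | ∃ l : List (V × W),
    t = (l.map fun vw => vw.1 ⊗ₜ[ℝ] vw.2).sum ∧
    s = (l.map fun vw => p vw.1 * q vw.2).sum }

variable {p q}

theorem tmul_mem_costs (v : V) (w : W) : p v * q w ∈ costs p q (v ⊗ₜ[ℝ] w) :=
  ⟨[(v, w)], by simp, by simp⟩

theorem zero_mem_costs : (0 : ℝ) ∈ costs p q 0 :=
  ⟨[], by simp, by simp⟩

theorem add_mem_costs {t t' : V ⊗[ℝ] W} {s s' : ℝ} (h : s ∈ costs p q t)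
    (h' : s' ∈ costs p q t') : s + s' ∈ costs p q (t + t') := by
  obtain ⟨l, rfl, rfl⟩ := h
  obtain ⟨l', rfl, rfl⟩ := h'
  exact ⟨l ++ l', by simp, by simp⟩

theorem smul_mem_costs (r : ℝ) {t : V ⊗[ℝ] W} {s : ℝ} (h : s ∈ costs p q t) :
    ‖r‖ * s ∈ costs p q (r • t) := by
  obtain ⟨l, rfl, rfl⟩ := h
  refine ⟨l.map fun vw => (r • vw.1, vw.2), ?_, ?_⟩
  · simp [List.smul_sum, Function.comp_def, TensorProduct.smul_tmul']
  · simp [Function.comp_def, map_smul_eq_mul, mul_assoc, List.sum_map_mul_left]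

theorem costs_nonempty (t : V ⊗[ℝ] W) : (costs p q t).Nonempty := by
  induction t with
  | zero => exact ⟨0, zero_mem_costs⟩
  | tmul v w => exact ⟨_, tmul_mem_costs v w⟩
  | add t t' h h' =>
    obtain ⟨s, hs⟩ := h
    obtain ⟨s', hs'⟩ := h'
    exact ⟨_, add_mem_costs hs hs'⟩

theorem nonneg_of_mem_costs {t : V ⊗[ℝ] W} {s : ℝ} (h : s ∈ costs p q t) : 0 ≤ s := by
  obtain ⟨l, -, rfl⟩ := h
  refine List.sum_nonneg fun x hx => ?_
  obtain ⟨vw, -, rfl⟩ := List.mem_map.1 hx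
  positivity

theorem costs_bddBelow (t : V ⊗[ℝ] W) : BddBelow (costs p q t) :=
  ⟨0, fun _ => nonneg_of_mem_costs⟩

/-- A product functional dominated by `p` and `q` is dominated by the cost of any
representation. -/
theorem lift_le_of_mem_costs {f : Module.Dual ℝ V} {g : Module.Dual ℝ W}
    (hf : ∀ x, |f x| ≤ p x) (hg : ∀ y, |g y| ≤ q y) {t : V ⊗[ℝ] W} {s : ℝ}
    (h : s ∈ costs p q t) : TensorProduct.lift ((LinearMap.mul ℝ ℝ).compl₁₂ f g) t ≤ s := by
  obtain ⟨l, rfl, rfl⟩ := h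
  rw [map_list_sum, List.map_map]
  refine List.sum_le_sum fun vw _ => ?_
  calc f vw.1 * g vw.2 ≤ |f vw.1| * |g vw.2| := (le_abs_self _).trans (abs_mul _ _).le
    _ ≤ p vw.1 * q vw.2 := mul_le_mul (hf _) (hg _) (abs_nonneg _) (apply_nonneg p _)

variable (p q)

/-- The projective tensor seminorm of `p` and `q`. -/
noncomputable def projectiveSeminorm : Seminorm ℝ (V ⊗[ℝ] W) :=
  Seminorm.ofSMulLE (fun t => sInf (costs p q t))
    (le_antisymm (csInf_le (costs_bddBelow 0) zero_mem_costs)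
      (le_csInf (costs_nonempty 0) fun _ => nonneg_of_mem_costs))
    (fun t t' => by
      rw [← csInf_add (costs_nonempty t) (costs_bddBelow t) (costs_nonempty t')
        (costs_bddBelow t')]
      refine csInf_le_csInf (costs_bddBelow _) ((costs_nonempty t).add (costs_nonempty t')) ?_
      rintro _ ⟨s, hs, s', hs', rfl⟩
      exact add_mem_costs hs hs')
    (fun r t => by
      rw [← smul_eq_mul, ← Real.sInf_smul_of_nonneg (norm_nonneg r)]
      refine csInf_le_csInf (costs_bddBelow _) (costs_nonempty t).smul_set ?_
      rintro _ ⟨s, hs, rfl⟩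
      exact smul_mem_costs r hs)

theorem projectiveSeminorm_apply (t : V ⊗[ℝ] W) :
    projectiveSeminorm p q t = sInf (costs p q t) :=
  rfl

theorem projectiveSeminorm_tmul (v : V) (w : W) :
    projectiveSeminorm p q (v ⊗ₜ[ℝ] w) = p v * q w := by
  refine le_antisymm (csInf_le (costs_bddBelow _) (tmul_mem_costs v w))
    (le_csInf (costs_nonempty _) fun s hs => ?_)
  obtain ⟨f, hfv, hf⟩ := p.exists_dual_apply_eq v
  obtain ⟨g, hgw, hg⟩ := q.exists_dual_apply_eq w
  simpa [hfv, hgw] using lift_le_of_mem_costs hf hg hs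

end ProjectiveSeminorm

/-- The projective tensor seminorm:  given seminorms `p` on `V` and `q` on `W`, the map
`t ↦ inf { Σ p(v_k) q(w_k) : t = Σ v_k ⊗ w_k }` is a seminorm on `V ⊗ W`, and on pure
tensors it satisfies `(p ⊗ q)(v ⊗ w) = p(v) * q(w)`. -/
theorem projective_tensor_seminorm_exists
    {V W : Type*} [AddCommGroup V] [Module ℝ V] [AddCommGroup W] [Module ℝ W]
    (p : Seminorm ℝ V) (q : Seminorm ℝ W) :
    ∃ P : Seminorm ℝ (V ⊗[ℝ] W),
      (∀ t : V ⊗[ℝ] W,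
        P t = sInf { s : ℝ | ∃ l : List (V × W),
          t = (l.map fun vw => vw.1 ⊗ₜ[ℝ] vw.2).sum ∧
          s = (l.map fun vw => p vw.1 * q vw.2).sum }) ∧
      ∀ (v : V) (w : W), P (v ⊗ₜ[ℝ] w) = p v * q w := by
  exact ⟨ProjectiveSeminorm.projectiveSeminorm p q,
    ProjectiveSeminorm.projectiveSeminorm_apply p q,
    ProjectiveSeminorm.projectiveSeminorm_tmul p q⟩
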